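/- arXiv:2604.10010 — 2 statements merged into one kernel-verified Lean document; each statement's English description precedes it below -/
import Mathlib

section
/- Let L > 0 and let (Ω, 𝓕, ℙ) be a probability space. Let v, w : Ω × ℝ → ℝ be jointly measurable and such that for ℙ-a.e. ω: the map x ↦ v(ω, x) is three times continuously differentiable, nonnegative and L-periodic, and the map x ↦ w(ω, x) is continuous, strictly positive and L-periodic. Assume that the functions ω ↦ ∫₀ᴸ v(ω,x)² / w(ω,x) dx, ω ↦ ∫₀ᴸ w(ω,x) (∂ₓ³ v(ω,x))² dx and ω ↦ ∫₀ᴸ (∂ₓ v(ω,x))² dx are ℙ-integrable. Then E[∫₀ᴸ v²/w dx] · E[∫₀ᴸ w (∂ₓ³ v)² dx] ≥ (9 / (4 L²)) · ( E[∫₀ᴸ (∂ₓ v)² dx] )². -/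
open Set MeasureTheory intervalIntegral

theorem IsLocalMin.deriv_deriv_nonneg {f : ℝ → ℝ} {a : ℝ} (hf : ContinuousAt f a)
    (h : IsLocalMin f a) : 0 ≤ deriv (deriv f) a := by
  by_contra! hneg
  have hmax : IsLocalMax f a := isLocalMax_of_deriv_deriv_neg hneg h.deriv_eq_zero hf
  have hconst : f =ᶠ[nhds a] fun _ => f a := by
    filter_upwards [h, hmax] with x h₁ h₂ using le_antisymm h₂ h₁
  have hzero : deriv (deriv f) a = 0 := by simpa using hconst.deriv.deriv_eq
  exact hneg.ne hzero

theorem Function.Periodic.deriv {f : ℝ → ℝ} {L : ℝ} (hf : Function.Periodic f L) :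
    Function.Periodic (deriv f) L := fun x => by
  rw [← deriv_comp_add_const, funext hf]

theorem Function.Periodic.exists_forall_le_of_continuous {f : ℝ → ℝ} {L : ℝ}
    (hf : Function.Periodic f L) (hL : L ≠ 0) (hc : Continuous f) : ∃ a, ∀ x, f a ≤ f x := by
  obtain ⟨_, ⟨⟨a, rfl⟩, ha⟩⟩ :=
    (hf.compact_of_continuous hL hc).exists_isLeast (range_nonempty f)
  exact ⟨a, fun x => ha (mem_range_self x)⟩

/-- A quadratic polynomial which is nonnegative on the nonnegative half-line and has nonpositive
linear coefficient has nonpositive discriminant. -/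
theorem sq_le_mul_of_forall_nonneg_le {a b c : ℝ} (ha : 0 ≤ a) (hb : 0 ≤ b) (hc : 0 ≤ c)
    (h : ∀ s, 0 ≤ s → 2 * s * b ≤ s ^ 2 * a + c) : b ^ 2 ≤ a * c := by
  have hd : discrim a (-2 * b) c ≤ 0 := discrim_le_zero fun s => by
    rcases le_total 0 s with hs | hs
    · nlinarith [h s hs]
    · nlinarith [mul_nonneg ha (mul_self_nonneg s), mul_nonneg hb (neg_nonneg.2 hs)]
  unfold discrim at hd
  nlinarith

/-- The deterministic interpolation inequality, in the form obtained from Young's inequality with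
parameter `s`. -/
theorem integral_deriv_sq_le_of_periodic {f w : ℝ → ℝ} {L s : ℝ} (hL : 0 < L) (hs : 0 ≤ s)
    (hf : ContDiff ℝ 3 f) (hf0 : ∀ x, 0 ≤ f x) (hfp : Function.Periodic f L)
    (hw : Continuous w) (hw0 : ∀ x, 0 < w x) (hwp : Function.Periodic w L) :
    3 * s * (∫ x in (0 : ℝ)..L, deriv f x ^ 2) ≤
      L * (s ^ 2 * (∫ x in (0 : ℝ)..L, f x ^ 2 / w x) +
        ∫ x in (0 : ℝ)..L, w x * iteratedDeriv 3 f x ^ 2) := by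
  have e3 : iteratedDeriv 3 f = deriv (deriv (deriv f)) := by
    simp only [iteratedDeriv_succ, iteratedDeriv_zero]
  rw [e3]
  have hf1 : ContDiff ℝ 2 (deriv f) := ((contDiff_succ_iff_deriv (n := 2)).1 hf).2.2
  have hf2 : ContDiff ℝ 1 (deriv (deriv f)) := ((contDiff_succ_iff_deriv (n := 1)).1 hf1).2.2
  have c0 : Continuous f := hf.continuous
  have c1 : Continuous (deriv f) := hf1.continuous
  have c2 : Continuous (deriv (deriv f)) := hf2.continuous
  have c3 : Continuous (deriv (deriv (deriv f))) := hf2.continuous_deriv le_rfl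
  have d0 (x) : HasDerivAt f (deriv f x) x :=
    (hf.differentiable (by norm_num) x).hasDerivAt
  have d1 (x) : HasDerivAt (deriv f) (deriv (deriv f) x) x :=
    (hf1.differentiable (by norm_num) x).hasDerivAt
  have d2 (x) : HasDerivAt (deriv (deriv f)) (deriv (deriv (deriv f)) x) x :=
    (hf2.differentiable (by norm_num) x).hasDerivAt
  obtain ⟨a, ha⟩ := hfp.exists_forall_le_of_continuous hL.ne' c0
  have hmin : IsLocalMin f a := Filter.Eventually.of_forall ha
  have ha1 : deriv f a = 0 := hmin.deriv_eq_zero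
  have ha2 : 0 ≤ deriv (deriv f) a := hmin.deriv_deriv_nonneg c0.continuousAt
  have cw1 : Continuous fun x => f x ^ 2 / w x := (c0.pow 2).div hw fun x => (hw0 x).ne'
  have cw2 : Continuous fun x => w x * deriv (deriv (deriv f)) x ^ 2 := hw.mul (c3.pow 2)
  have csw : Continuous fun x => s ^ 2 * (f x ^ 2 / w x) := continuous_const.mul cw1
  have c02 : Continuous fun x => f x * deriv (deriv f) x := c0.mul c2
  have c03 : Continuous fun x => f x * deriv (deriv (deriv f)) x := c0.mul c3
  have c11 : Continuous fun x => deriv f x ^ 2 / 2 := (c1.pow 2).div_const 2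
  set h : ℝ → ℝ := fun x => s ^ 2 * (f x ^ 2 / w x) + w x * deriv (deriv (deriv f)) x ^ 2
    with h_def
  have ch : Continuous h := csw.add cw2
  have h0 (x) : 0 ≤ h x := by have := hw0 x; positivity
  have young (x) : -2 * s * (f x * deriv (deriv (deriv f)) x) ≤ h x := by
    have hx := hw0 x
    have : h x + 2 * s * (f x * deriv (deriv (deriv f)) x) =
        (s * f x + w x * deriv (deriv (deriv f)) x) ^ 2 / w x := by
      simp only [h_def]; field_simp; ring
    have : 0 ≤ (s * f x + w x * deriv (deriv (deriv f)) x) ^ 2 / w x := by positivity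
    linarith
  have per (g : ℝ → ℝ) (hg : Function.Periodic g L) :
      ∫ x in a..a + L, g x = ∫ x in (0 : ℝ)..L, g x := by
    simpa using hg.intervalIntegral_add_eq a 0
  have hH : ∫ x in a..a + L, h x = s ^ 2 * (∫ x in (0 : ℝ)..L, f x ^ 2 / w x) +
      ∫ x in (0 : ℝ)..L, w x * deriv (deriv (deriv f)) x ^ 2 := by
    rw [per h fun x => by simp only [h_def, hfp x, hwp x, hfp.deriv.deriv.deriv x],
      ← intervalIntegral.integral_const_mul, ← intervalIntegral.integral_add
        (csw.intervalIntegrable _ _) (cw2.intervalIntegrable _ _)]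
  have primitive (y) : ∫ x in a..y, f x * deriv (deriv (deriv f)) x =
      (f y * deriv (deriv f) y - deriv f y ^ 2 / 2) - f a * deriv (deriv f) a := by
    rw [intervalIntegral.integral_eq_sub_of_hasDerivAt
      (f := fun y => f y * deriv (deriv f) y - deriv f y ^ 2 / 2)
      (fun x _ => ?_) (c03.intervalIntegrable _ _)]
    · simp [ha1]
    · refine (((d0 x).mul (d2 x)).sub (((d1 x).pow 2).div_const 2)).congr_deriv ?_
      norm_num
      ring
  have bound (y) (hy : y ∈ Icc a (a + L)) :
      -2 * s * (f y * deriv (deriv f) y - deriv f y ^ 2 / 2) ≤ ∫ x in a..a + L, h x := calc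
    _ ≤ -2 * s * ∫ x in a..y, f x * deriv (deriv (deriv f)) x := by
      rw [primitive]; nlinarith [mul_nonneg hs (mul_nonneg (hf0 a) ha2)]
    _ = ∫ x in a..y, -2 * s * (f x * deriv (deriv (deriv f)) x) :=
      (intervalIntegral.integral_const_mul _ _).symm
    _ ≤ ∫ x in a..y, h x := intervalIntegral.integral_mono_on hy.1
      ((continuous_const.mul c03).intervalIntegrable _ _) (ch.intervalIntegrable _ _)
      fun x _ => young x
    _ ≤ ∫ x in a..a + L, h x := intervalIntegral.integral_mono_interval le_rfl hy.1 hy.2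
      (Filter.Eventually.of_forall h0) (ch.intervalIntegrable _ _)
  have parts : ∫ x in (0 : ℝ)..L, f x * deriv (deriv f) x =
      -∫ x in (0 : ℝ)..L, deriv f x ^ 2 := by
    rw [intervalIntegral.integral_mul_deriv_eq_deriv_mul (fun x _ => d0 x) (fun x _ => d1 x)
      (c1.intervalIntegrable _ _) (c2.intervalIntegrable _ _)]
    have e0 : f L = f 0 := by simpa using hfp 0
    have e1 : deriv f L = deriv f 0 := by simpa using hfp.deriv 0
    simp [e0, e1, sq]
  have key : ∫ y in a..a + L, -2 * s * (f y * deriv (deriv f) y - deriv f y ^ 2 / 2) ≤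
      ∫ _ in a..a + L, ∫ x in a..a + L, h x :=
    intervalIntegral.integral_mono_on (by linarith)
      ((continuous_const.mul (c02.sub c11)).intervalIntegrable _ _)
      (continuous_const.intervalIntegrable _ _) bound
  rw [intervalIntegral.integral_const_mul, per _ fun x => by
      simp only [hfp x, hfp.deriv x, hfp.deriv.deriv x],
    intervalIntegral.integral_sub (c02.intervalIntegrable _ _)
      (c11.intervalIntegrable _ _),
    intervalIntegral.integral_div, parts, intervalIntegral.integral_const, hH,
    add_sub_cancel_left, smul_eq_mul] at key
  linarith

/-- Probabilistic weighted interpolation inequality (probabilistic analogue of Tudorascu's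
Lemma 1): for random `L`-periodic functions `v` (nonnegative, `C³`) and `w` (continuous,
positive),
`E[∫₀ᴸ v²/w] · E[∫₀ᴸ w (∂ₓ³v)²] ≥ (9/(4L²)) (E[∫₀ᴸ (∂ₓv)²])²`. -/
theorem weighted_entropy_energy_inequality
    {Ω : Type*} [MeasurableSpace Ω] (ℙ : Measure Ω) [IsProbabilityMeasure ℙ]
    (L : ℝ) (hL : 0 < L) (v w : Ω × ℝ → ℝ)
    (hv_meas : Measurable v) (hw_meas : Measurable w)
    (hae : ∀ᵐ ω ∂ℙ,
      ContDiff ℝ 3 (fun x => v (ω, x)) ∧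
      (∀ x : ℝ, 0 ≤ v (ω, x)) ∧
      (∀ x : ℝ, v (ω, x + L) = v (ω, x)) ∧
      Continuous (fun x => w (ω, x)) ∧
      (∀ x : ℝ, 0 < w (ω, x)) ∧
      (∀ x : ℝ, w (ω, x + L) = w (ω, x)))
    (hint1 : Integrable (fun ω => ∫ x in (0 : ℝ)..L, v (ω, x) ^ 2 / w (ω, x)) ℙ)
    (hint2 : Integrable
      (fun ω => ∫ x in (0 : ℝ)..L,
        w (ω, x) * (iteratedDeriv 3 (fun y => v (ω, y)) x) ^ 2) ℙ)
    (hint3 : Integrable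
      (fun ω => ∫ x in (0 : ℝ)..L, (deriv (fun y => v (ω, y)) x) ^ 2) ℙ) :
    (∫ ω, (∫ x in (0 : ℝ)..L, v (ω, x) ^ 2 / w (ω, x)) ∂ℙ) *
      (∫ ω, (∫ x in (0 : ℝ)..L,
        w (ω, x) * (iteratedDeriv 3 (fun y => v (ω, y)) x) ^ 2) ∂ℙ) ≥
      (9 / (4 * L ^ 2)) *
        (∫ ω, (∫ x in (0 : ℝ)..L, (deriv (fun y => v (ω, y)) x) ^ 2) ∂ℙ) ^ 2 := by
  set A := fun ω => ∫ x in (0 : ℝ)..L, v (ω, x) ^ 2 / w (ω, x)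
  set B := fun ω => ∫ x in (0 : ℝ)..L,
    w (ω, x) * (iteratedDeriv 3 (fun y => v (ω, y)) x) ^ 2
  set D := fun ω => ∫ x in (0 : ℝ)..L, (deriv (fun y => v (ω, y)) x) ^ 2
  have hA : 0 ≤ ∫ ω, A ω ∂ℙ := by
    refine integral_nonneg_of_ae ?_
    filter_upwards [hae] with ω ⟨_, _, _, _, hw0, _⟩
    exact intervalIntegral.integral_nonneg hL.le fun x _ => div_nonneg (sq_nonneg _) (hw0 x).le
  have hB : 0 ≤ ∫ ω, B ω ∂ℙ := by
    refine integral_nonneg_of_ae ?_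
    filter_upwards [hae] with ω ⟨_, _, _, _, hw0, _⟩
    exact intervalIntegral.integral_nonneg hL.le fun x _ => mul_nonneg (hw0 x).le (sq_nonneg _)
  have hD : 0 ≤ ∫ ω, D ω ∂ℙ :=
    integral_nonneg fun ω => intervalIntegral.integral_nonneg hL.le fun x _ => sq_nonneg _
  have hexp (s : ℝ) (hs : 0 ≤ s) :
      3 * s * ∫ ω, D ω ∂ℙ ≤ L * (s ^ 2 * (∫ ω, A ω ∂ℙ) + ∫ ω, B ω ∂ℙ) := by
    rw [← MeasureTheory.integral_const_mul, ← MeasureTheory.integral_const_mul, ← MeasureTheory.integral_add (hint1.const_mul _) hint2,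
      ← MeasureTheory.integral_const_mul]
    refine integral_mono_ae (hint3.const_mul _) (((hint1.const_mul _).add hint2).const_mul _) ?_
    filter_upwards [hae] with ω ⟨hv, hv0, hvp, hw, hw0, hwp⟩
    exact integral_deriv_sq_le_of_periodic hL hs hv hv0 hvp hw hw0 hwp
  have hsq : (3 / (2 * L) * ∫ ω, D ω ∂ℙ) ^ 2 ≤ (∫ ω, A ω ∂ℙ) * ∫ ω, B ω ∂ℙ := by
    refine sq_le_mul_of_forall_nonneg_le hA (by positivity) hB fun s hs => ?_
    refine le_of_mul_le_mul_left (le_trans (le_of_eq ?_) (hexp s hs)) hL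
    field_simp
  refine ge_iff_le.2 (le_trans (le_of_eq ?_) hsq)
  field_simp
  ring
end

section
/- Let L > 0, K > 0, let n ≥ 4 be a real number, and let u : [0, L] → [0, ∞) satisfy the Hölder bound |u(x) − u(y)| ≤ K |x − y|^{1/2} for all x, y ∈ [0, L]. Suppose u(x₀) = 0 for some x₀ ∈ [0, L]. Then ∫₀ᴸ u(x)^{2−n} dx = +∞, i.e. the extended-real-valued Lebesgue integral over [0, L] of the function x ↦ u(x)^{2−n} (with the convention 0^{2−n} = +∞) is infinite. -/
open Set MeasureTheory

/-- The function `x ↦ |x - c|⁻¹` has infinite integral over every nondegenerate compact interval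
containing `c`. -/
theorem lintegral_Icc_enorm_sub_inv_eq_top {a b c : ℝ} (hab : a < b) (hc : c ∈ Set.Icc a b) :
    ∫⁻ x in Set.Icc a b, ‖(x - c)⁻¹‖ₑ = ⊤ := by
  by_contra h
  have hint : IntegrableOn (fun x : ℝ => (x - c)⁻¹) (Set.Icc a b) :=
    ⟨by fun_prop, lt_top_iff_ne_top.mpr h⟩
  have hii : IntervalIntegrable (fun x : ℝ => (x - c)⁻¹) volume a b :=
    (intervalIntegrable_iff_integrableOn_Icc_of_le hab.le).mpr hint
  rw [intervalIntegrable_sub_inv_iff, Set.uIcc_of_le hab.le] at hii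
  exact hii.elim hab.ne fun h => h hc

/-- If `v ≤ K d^{1/2}` with `0 < d ≤ L`, then `v^{2-n}` dominates a fixed multiple of `d⁻¹`
as soon as `n ≥ 4`. -/
theorem mul_inv_le_rpow_of_le_mul_sqrt {L K n v d : ℝ} (hK : 0 < K) (hn : 4 ≤ n)
    (hv : 0 < v) (hd : 0 < d) (hdL : d ≤ L) (hvd : v ≤ K * d ^ ((1 : ℝ) / 2)) :
    K ^ (2 - n) * L ^ ((4 - n) / 2) * d⁻¹ ≤ v ^ (2 - n) :=
  calc K ^ (2 - n) * L ^ ((4 - n) / 2) * d⁻¹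
      ≤ K ^ (2 - n) * d ^ ((4 - n) / 2) * d⁻¹ := by
        have hpow : L ^ ((4 - n) / 2) ≤ d ^ ((4 - n) / 2) :=
          Real.rpow_le_rpow_of_nonpos hd hdL (by linarith)
        gcongr K ^ (2 - n) * ?_ * d⁻¹
    _ = (K * d ^ ((1 : ℝ) / 2)) ^ (2 - n) := by
        rw [Real.mul_rpow hK.le (by positivity), ← Real.rpow_mul hd.le, mul_assoc,
          ← Real.rpow_neg_one d, ← Real.rpow_add hd]
        ring_nf
    _ ≤ v ^ (2 - n) := Real.rpow_le_rpow_of_nonpos hv hvd (by linarith)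

/-- If a nonnegative `1/2`-Hölder continuous function on `[0, L]` vanishes at some point,
then for `n ≥ 4` the entropy integral `∫₀ᴸ u^{2-n}` (extended-real valued, with the
convention `0^{2-n} = ∞`) diverges. -/
theorem entropy_integral_eq_top_of_vanishing
    (L K n : ℝ) (hL : 0 < L) (hK : 0 < K) (hn : 4 ≤ n)
    (u : ℝ → ℝ) (hu_nonneg : ∀ x ∈ Set.Icc (0 : ℝ) L, 0 ≤ u x)
    (hu_holder : ∀ x ∈ Set.Icc (0 : ℝ) L, ∀ y ∈ Set.Icc (0 : ℝ) L,
      |u x - u y| ≤ K * |x - y| ^ ((1 : ℝ) / 2))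
    (x₀ : ℝ) (hx₀ : x₀ ∈ Set.Icc (0 : ℝ) L) (hu0 : u x₀ = 0) :
    ∫⁻ x in Set.Icc (0 : ℝ) L, ENNReal.ofReal (u x) ^ (2 - n) ∂volume = ⊤ := by
  set C : ℝ := K ^ (2 - n) * L ^ ((4 - n) / 2)
  have hC_pos : 0 < C := by positivity
  have hbound : ∀ x ∈ Set.Icc (0 : ℝ) L,
      ENNReal.ofReal C * ‖(x - x₀)⁻¹‖ₑ ≤ ENNReal.ofReal (u x) ^ (2 - n) := by
    intro x hx
    rcases (hu_nonneg x hx).eq_or_lt with hux | hux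
    · rw [← hux, ENNReal.ofReal_zero, ENNReal.zero_rpow_of_neg (by linarith)]
      exact le_top
    · have hne : x ≠ x₀ := by
        rintro rfl
        exact hux.ne' hu0
      have hle : u x ≤ K * |x - x₀| ^ ((1 : ℝ) / 2) := by
        simpa only [hu0, sub_zero, abs_of_pos hux] using hu_holder x hx x₀ hx₀
      have hdist : |x - x₀| ≤ L :=
        abs_le.mpr ⟨by linarith [hx.1, hx₀.2], by linarith [hx.2, hx₀.1]⟩
      rw [ENNReal.ofReal_rpow_of_pos hux, Real.enorm_eq_ofReal_abs, abs_inv,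
        ← ENNReal.ofReal_mul hC_pos.le]
      exact ENNReal.ofReal_le_ofReal
        (mul_inv_le_rpow_of_le_mul_sqrt hK hn hux (abs_pos.mpr (sub_ne_zero.mpr hne)) hdist hle)
  refine top_le_iff.mp ?_
  calc (⊤ : ENNReal)
      = ENNReal.ofReal C * ∫⁻ x in Set.Icc (0 : ℝ) L, ‖(x - x₀)⁻¹‖ₑ := by
        rw [lintegral_Icc_enorm_sub_inv_eq_top hL hx₀,
          ENNReal.mul_top (ENNReal.ofReal_pos.mpr hC_pos).ne']
    _ = ∫⁻ x in Set.Icc (0 : ℝ) L, ENNReal.ofReal C * ‖(x - x₀)⁻¹‖ₑ :=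
        (lintegral_const_mul' _ _ ENNReal.ofReal_ne_top).symm
    _ ≤ ∫⁻ x in Set.Icc (0 : ℝ) L, ENNReal.ofReal (u x) ^ (2 - n) :=
        setLIntegral_mono' measurableSet_Icc hbound
end
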